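/- Suppose (n−1)² < (v̄ − c)/(m − c). Then c is the unique maxmin reserve price: for every r ≥ 0 with r ≠ c, inf_{F ∈ Δ₁(m,v̄)} R(F,r) < inf_{F ∈ Δ₁(m,v̄)} R(F,c). -/

import Mathlib

open MeasureTheory Set Filter

/-- Expected revenue of a second-price auction with `n` bidders, seller's valuation `c`,
value cdf `F` and reserve price `r`. -/
noncomputable def revenue (n : ℕ) (c : ℝ) (F : ℝ → ℝ) (r : ℝ) : ℝ :=
  r - (r - c) * F r ^ n +
    ∫ v in Set.Ioi r, (1 - (n : ℝ) * F v ^ (n - 1) + ((n : ℝ) - 1) * F v ^ n)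

/-- The set of cdfs with support in `[0, vbar]` and mean `m`. -/
def Delta1 (m vbar : ℝ) (F : ℝ → ℝ) : Prop :=
  Monotone F ∧ (∀ x, ContinuousWithinAt F (Set.Ici x) x) ∧
    (∀ v < 0, F v = 0) ∧ (∀ v ≥ vbar, F v = 1) ∧
    (∫ v in (0:ℝ)..vbar, (1 - F v)) = m

/-- The integrand of the revenue formula: the probability that at least two of `n` values exceed a
point whose cdf value is `x`. -/
noncomputable def secondOrderTail (n : ℕ) (x : ℝ) : ℝ :=
  1 - (n : ℝ) * x ^ (n - 1) + ((n : ℝ) - 1) * x ^ n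

theorem secondOrderTail_nonneg (k : ℕ) {x : ℝ} (hx : 0 ≤ x) :
    0 ≤ 1 - ((k : ℝ) + 1) * x ^ k + (k : ℝ) * x ^ (k + 1) := by
  induction k with
  | zero => simp
  | succ k ih =>
    have key : 0 ≤ (1 - x) * (1 - x ^ (k + 1)) := by
      rcases le_total x 1 with h | h
      · exact mul_nonneg (by linarith) (by linarith [pow_le_one₀ hx h (n := k + 1)])
      · exact mul_nonneg_of_nonpos_of_nonpos (by linarith)
          (by linarith [one_le_pow₀ h (n := k + 1)])
    have := mul_nonneg hx ih
    push_cast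
    ring_nf at this key ⊢
    linarith

theorem secondOrderTail_pos (k : ℕ) {x : ℝ} (hx : 0 ≤ x) (hx1 : x < 1) :
    0 < 1 - ((k : ℝ) + 2) * x ^ (k + 1) + ((k : ℝ) + 1) * x ^ (k + 2) := by
  have key : 0 < (1 - x) * (1 - x ^ (k + 1)) :=
    mul_pos (by linarith) (by linarith [pow_lt_one₀ hx hx1 (n := k + 1) (by lia)])
  have := mul_nonneg hx (secondOrderTail_nonneg k hx)
  ring_nf at this key ⊢
  linarith

theorem secondOrderTail_add_two (k : ℕ) (x : ℝ) :
    secondOrderTail (k + 2) x = 1 - ((k : ℝ) + 2) * x ^ (k + 1) + ((k : ℝ) + 1) * x ^ (k + 2) := by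
  simp only [secondOrderTail, show k + 2 - 1 = k + 1 from rfl]
  push_cast
  ring

theorem secondOrderTail_zero (k : ℕ) : secondOrderTail (k + 2) 0 = 1 := by
  rw [secondOrderTail_add_two]; simp

theorem secondOrderTail_one (k : ℕ) : secondOrderTail (k + 2) 1 = 0 := by
  rw [secondOrderTail_add_two]; simp; ring

/-- The tangent to `secondOrderTail` at `p` lies below it on `[0, ∞)` once `p` is beyond
`1 - 1 / (n - 1) ^ 2`, with an explicit gap. -/
theorem secondOrderTail_tangent_gap (k : ℕ) {p x : ℝ} (hp : 0 < p) (hx : 0 ≤ x) :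
    (((k : ℝ) + 1) ^ 2 * p - ((k : ℝ) + 2) * k) *
        (x ^ (k + 2) - p ^ (k + 2) - ((k : ℝ) + 2) * p ^ (k + 1) * (x - p)) ≤
      ((k : ℝ) + 1) * p * (secondOrderTail (k + 2) x - (secondOrderTail (k + 2) p -
        ((k : ℝ) + 2) * (k + 1) * p ^ k * (1 - p) * (x - p))) := by
  obtain ⟨s, rfl⟩ : ∃ s, x = p * s := ⟨x / p, by field_simp⟩
  have hs : 0 ≤ s := nonneg_of_mul_nonneg_right hx hp
  have h := mul_nonneg (mul_nonneg (mul_nonneg (by positivity : 0 ≤ (k : ℝ) + 2)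
    (pow_nonneg hp.le (k + 2))) hs) (secondOrderTail_nonneg k hs)
  rw [secondOrderTail_add_two, secondOrderTail_add_two]
  simp only [mul_pow]
  ring_nf at h ⊢
  linarith

theorem bernoulli_gap_nonneg (k : ℕ) {p x : ℝ} (hp : 0 < p) (hx : 0 ≤ x) :
    0 ≤ x ^ (k + 2) - p ^ (k + 2) - ((k : ℝ) + 2) * p ^ (k + 1) * (x - p) := by
  obtain ⟨s, rfl⟩ : ∃ s, x = p * s := ⟨x / p, by field_simp⟩
  have hs : 0 ≤ s := nonneg_of_mul_nonneg_right hx hp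
  have h := one_add_mul_le_pow (a := s - 1) (by linarith) (k + 2)
  have h2 := mul_nonneg (pow_nonneg hp.le (k + 2)) (sub_nonneg.2 h)
  push_cast at h2
  simp only [mul_pow]
  ring_nf at h2 ⊢
  linarith

theorem secondOrderTail_tangent_le (k : ℕ) {p x : ℝ} (hp : 0 < p) (hx : 0 ≤ x)
    (h : ((k : ℝ) + 1) ^ 2 * (1 - p) < 1) :
    secondOrderTail (k + 2) p - ((k : ℝ) + 2) * (k + 1) * p ^ k * (1 - p) * (x - p) ≤
      secondOrderTail (k + 2) x := by
  have h1 := secondOrderTail_tangent_gap k hp hx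
  have h2 := mul_nonneg (by nlinarith : 0 ≤ ((k : ℝ) + 1) ^ 2 * p - ((k : ℝ) + 2) * k)
    (bernoulli_gap_nonneg k hp hx)
  have h3 := nonneg_of_mul_nonneg_right (h2.trans h1) (by positivity)
  linarith

theorem secondOrderTail_tangent_zero_lt (k : ℕ) {p : ℝ} (hp : 0 < p)
    (h : ((k : ℝ) + 1) ^ 2 * (1 - p) < 1) :
    secondOrderTail (k + 2) p + ((k : ℝ) + 2) * (k + 1) * p ^ k * (1 - p) * p < 1 := by
  have h2 := mul_pos (pow_pos hp (k + 1))
    (by nlinarith : 0 < ((k : ℝ) + 1) ^ 2 * p - ((k : ℝ) + 2) * k)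
  rw [secondOrderTail_add_two]
  ring_nf at h2 ⊢
  linarith

namespace Delta1

variable {m vbar : ℝ} {F : ℝ → ℝ}

theorem nonneg (hF : Delta1 m vbar F) (v : ℝ) : 0 ≤ F v := by
  rw [← hF.2.2.1 (min v (-1)) (by simp)]
  exact hF.1 (min_le_left _ _)

theorem le_one (hF : Delta1 m vbar F) (v : ℝ) : F v ≤ 1 := by
  rw [← hF.2.2.2.1 (max v vbar) (le_max_right _ _)]
  exact hF.1 (le_max_left _ _)

theorem secondOrderTail_nonneg (hF : Delta1 m vbar F) (k : ℕ) (v : ℝ) :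
    0 ≤ secondOrderTail (k + 2) (F v) := by
  have := _root_.secondOrderTail_nonneg (k + 1) (hF.nonneg v)
  rw [secondOrderTail_add_two]
  push_cast at this
  ring_nf at this ⊢
  linarith

theorem intervalIntegrable (hF : Delta1 m vbar F) (a b : ℝ) :
    IntervalIntegrable F volume a b := hF.1.intervalIntegrable

theorem intervalIntegrable_secondOrderTail (hF : Delta1 m vbar F) (n : ℕ) (a b : ℝ) :
    IntervalIntegrable (fun v => secondOrderTail n (F v)) volume a b := by
  have hpow (j : ℕ) : IntervalIntegrable (fun v => F v ^ j) volume a b :=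
    Monotone.intervalIntegrable fun x y h => pow_le_pow_left₀ (hF.nonneg x) (hF.1 h) j
  exact (intervalIntegrable_const.sub ((hpow _).const_mul _)).add ((hpow _).const_mul _)

theorem revenue_eq (hF : Delta1 m vbar F) (k : ℕ) (c : ℝ) {r : ℝ} (hr : r ≤ vbar) :
    revenue (k + 2) c F r = r - (r - c) * F r ^ (k + 2) +
      ∫ v in r..vbar, secondOrderTail (k + 2) (F v) := by
  rw [intervalIntegral.integral_of_le hr]
  unfold revenue
  congr 1
  apply setIntegral_eq_of_subset_of_forall_sdiff_eq_zero measurableSet_Ioi Ioc_subset_Ioi_self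
  intro x hx
  have hx' : vbar ≤ x := by
    by_contra! h
    exact hx.2 ⟨hx.1, h.le⟩
  change secondOrderTail (k + 2) (F x) = 0
  rw [hF.2.2.2.1 x hx', secondOrderTail_one]

theorem le_revenue (hF : Delta1 m vbar F) (k : ℕ) (c r : ℝ) :
    r - |r - c| ≤ revenue (k + 2) c F r := by
  have h1 : 0 ≤ ∫ v in Ioi r, secondOrderTail (k + 2) (F v) :=
    integral_nonneg fun v => hF.secondOrderTail_nonneg k v
  have h2 : (r - c) * F r ^ (k + 2) ≤ |r - c| := by
    refine (le_abs_self _).trans ?_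
    rw [abs_mul, abs_of_nonneg (pow_nonneg (hF.nonneg r) _)]
    exact mul_le_of_le_one_right (abs_nonneg _) (pow_le_one₀ (hF.nonneg r) (hF.le_one r))
  change _ ≤ _ + ∫ v in Ioi r, secondOrderTail (k + 2) (F v)
  linarith

/-- The revenue guarantee at the reserve price `c`. -/
theorem guarantee_le_revenue (hF : Delta1 m vbar F) (k : ℕ) {c q : ℝ} (hc : 0 ≤ c)
    (hcv : c ≤ vbar) (hq : 0 < q) (hq1 : q ≤ 1) (hqm : (vbar - c) * q = vbar - m)
    (h : ((k : ℝ) + 1) ^ 2 * (1 - q) < 1) :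
    c + (vbar - c) * secondOrderTail (k + 2) q ≤ revenue (k + 2) c F c := by
  rw [hF.revenue_eq k c hcv]
  set d := ((k : ℝ) + 2) * (k + 1) * q ^ k * (1 - q) with hd
  have hd0 : 0 ≤ d := by
    have : 0 ≤ 1 - q := by linarith
    positivity
  have hint := hF.intervalIntegrable
  have h1 : ∫ v in c..vbar, (secondOrderTail (k + 2) q - d * (F v - q)) ≤
      ∫ v in c..vbar, secondOrderTail (k + 2) (F v) :=
    intervalIntegral.integral_mono hcv
      (intervalIntegrable_const.sub (((hint c vbar).sub intervalIntegrable_const).const_mul d))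
      (hF.intervalIntegrable_secondOrderTail _ _ _)
      fun v => secondOrderTail_tangent_le k hq (hF.nonneg v) h
  rw [intervalIntegral.integral_sub intervalIntegrable_const
      (((hint c vbar).sub intervalIntegrable_const).const_mul d),
    intervalIntegral.integral_const_mul,
    intervalIntegral.integral_sub (hint c vbar) intervalIntegrable_const] at h1
  simp only [intervalIntegral.integral_const, smul_eq_mul] at h1
  have h2 := hF.2.2.2.2
  rw [intervalIntegral.integral_sub intervalIntegrable_const (hint 0 vbar),
    ← intervalIntegral.integral_add_adjacent_intervals (hint 0 c) (hint c vbar)] at h2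
  simp only [intervalIntegral.integral_const, smul_eq_mul] at h2
  have h3 : 0 ≤ ∫ v in (0 : ℝ)..c, F v :=
    intervalIntegral.integral_nonneg hc fun v _ => hF.nonneg v
  have h4 : d * ((∫ v in c..vbar, F v) - (vbar - c) * q) ≤ 0 :=
    mul_nonpos_of_nonneg_of_nonpos hd0 (by linarith)
  linarith

end Delta1

/-- The cdf of the distribution with mass `p` at `s` and `1 - p` at `vbar`. -/
noncomputable def twoPointCdf (s p vbar : ℝ) (v : ℝ) : ℝ :=
  if v < s then 0 else if v < vbar then p else 1

theorem integral_comp_twoPointCdf (g : ℝ → ℝ) {s p vbar r : ℝ} (hr : r ≤ s) (hs : s ≤ vbar) :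
    ∫ v in r..vbar, g (twoPointCdf s p vbar v) = (s - r) * g 0 + (vbar - s) * g p := by
  have h0 : EqOn (fun _ => g 0) (fun v => g (twoPointCdf s p vbar v)) (Ioo r s) := by
    intro v hv
    simp [twoPointCdf, hv.2]
  have h1 : EqOn (fun _ => g p) (fun v => g (twoPointCdf s p vbar v)) (Ioo s vbar) := by
    intro v hv
    simp [twoPointCdf, hv.1.not_gt, hv.2]
  have i0 : IntervalIntegrable (fun v => g (twoPointCdf s p vbar v)) volume r s :=
    intervalIntegrable_const.congr_uIoo (by rwa [uIoo_of_le hr])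
  have i1 : IntervalIntegrable (fun v => g (twoPointCdf s p vbar v)) volume s vbar :=
    intervalIntegrable_const.congr_uIoo (by rwa [uIoo_of_le hs])
  rw [← intervalIntegral.integral_add_adjacent_intervals i0 i1,
    ← intervalIntegral.integral_congr_Ioo_of_le hr h0,
    ← intervalIntegral.integral_congr_Ioo_of_le hs h1]
  simp

theorem delta1_twoPointCdf {s p m vbar : ℝ} (hs : 0 ≤ s) (hsv : s < vbar) (hp : 0 ≤ p)
    (hp1 : p ≤ 1) (hm : (vbar - s) * p = vbar - m) : Delta1 m vbar (twoPointCdf s p vbar) := by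
  refine ⟨?_, ?_, ?_, ?_, ?_⟩
  · intro x y hxy
    unfold twoPointCdf
    split_ifs <;> linarith
  · intro x
    rcases lt_or_ge x s with h | h
    · refine ContinuousAt.continuousWithinAt
        (continuousAt_const (y := (0 : ℝ)) |>.congr ?_)
      filter_upwards [Iio_mem_nhds h] with y hy
      simp [twoPointCdf, mem_Iio.1 hy]
    rcases lt_or_ge x vbar with h' | h'
    · refine (continuousWithinAt_const (b := p)).congr_of_eventuallyEq ?_ (by
        simp [twoPointCdf, h, h'])
      filter_upwards [self_mem_nhdsWithin, mem_nhdsWithin_of_mem_nhds (Iio_mem_nhds h')] with y h1 h2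
      simp [twoPointCdf, h.trans h1, mem_Iio.1 h2]
    · have key (y : ℝ) (hy : x ≤ y) : twoPointCdf s p vbar y = 1 := by
        simp [twoPointCdf, (h.trans hy).not_gt, (h'.trans hy).not_gt]
      exact (continuousWithinAt_const (b := (1 : ℝ))).congr key (key x le_rfl)
  · intro v hv
    simp [twoPointCdf, hv.trans_le hs]
  · intro v hv
    simp [twoPointCdf, not_lt.2 hv, (hsv.le.trans hv).not_gt]
  · rw [integral_comp_twoPointCdf (fun x => 1 - x) hs hsv.le]
    linarith

theorem revenue_twoPointCdf_of_lt (k : ℕ) (c : ℝ) {s p m vbar r : ℝ} (hsv : s < vbar)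
    (hF : Delta1 m vbar (twoPointCdf s p vbar)) (hr : r < s) :
    revenue (k + 2) c (twoPointCdf s p vbar) r =
      s + (vbar - s) * secondOrderTail (k + 2) p := by
  rw [hF.revenue_eq k c (hr.trans hsv).le, integral_comp_twoPointCdf _ hr.le hsv.le,
    secondOrderTail_zero]
  simp [twoPointCdf, hr]
  ring

theorem revenue_twoPointCdf_self (k : ℕ) (c : ℝ) {s p m vbar : ℝ} (hsv : s < vbar)
    (hF : Delta1 m vbar (twoPointCdf s p vbar)) :
    revenue (k + 2) c (twoPointCdf s p vbar) s =
      s - (s - c) * p ^ (k + 2) + (vbar - s) * secondOrderTail (k + 2) p := by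
  rw [hF.revenue_eq k c hsv.le, integral_comp_twoPointCdf _ le_rfl hsv.le]
  simp [twoPointCdf, hsv]

theorem revenue_twoPointCdf_one (k : ℕ) (c vbar : ℝ) {m r : ℝ} (hr : m ≤ r) :
    revenue (k + 2) c (twoPointCdf m 1 vbar) r = c := by
  have key (v : ℝ) (hv : m ≤ v) : twoPointCdf m 1 vbar v = 1 := by simp [twoPointCdf, hv]
  have h : ∫ v in Ioi r, secondOrderTail (k + 2) (twoPointCdf m 1 vbar v) = 0 :=
    setIntegral_eq_zero_of_forall_eq_zero fun v hv => by
      rw [key v (hr.trans (le_of_lt hv)), secondOrderTail_one]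
  change _ + ∫ v in Ioi r, secondOrderTail (k + 2) (twoPointCdf m 1 vbar v) = c
  rw [h, key r hr]
  simp

/-- Raising the reserve price (and the lower atom with it) strictly lowers the revenue. -/
theorem revenue_lt_of_atom_raised (k : ℕ) {c r vbar p q : ℝ} (hcr : c < r) (hr : r < vbar)
    (hp : 0 < p) (hp1 : p ≤ 1) (hpq : (vbar - r) * p = (vbar - c) * q) :
    r - (r - c) * p ^ (k + 2) + (vbar - r) * secondOrderTail (k + 2) p <
      c + (vbar - c) * secondOrderTail (k + 2) q := by
  have hW : 0 < vbar - c := by linarith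
  obtain ⟨s, hs⟩ : ∃ s, vbar - r = (vbar - c) * s := ⟨(vbar - r) / (vbar - c), by field_simp⟩
  have hs0 : 0 ≤ s := by
    by_contra! h
    nlinarith
  have hs1 : s < 1 := by
    by_contra! h
    nlinarith
  obtain rfl : q = p * s := by
    apply mul_left_cancel₀ hW.ne'
    rw [← hpq, hs]; ring
  have h1 := mul_pos hp (secondOrderTail_pos k hs0 hs1)
  have h2 : 0 ≤ (1 - p) * (((k : ℝ) + 2) * (s * (1 - s ^ k))) :=
    mul_nonneg (by linarith) (mul_nonneg (by positivity)
      (mul_nonneg hs0 (by linarith [pow_le_one₀ hs0 hs1.le (n := k)])))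
  have h3 := mul_pos (mul_pos hW (pow_pos hp (k + 1))) (add_pos_of_pos_of_nonneg h1 h2)
  obtain rfl : r = vbar - (vbar - c) * s := by linarith
  rw [secondOrderTail_add_two, secondOrderTail_add_two]
  simp only [mul_pow]
  ring_nf at h3 ⊢
  linarith

/-- Moving the lower atom slightly below `c` strictly lowers the guarantee. -/
theorem guarantee_lt_of_atom_lowered (k : ℕ) {c s vbar p q : ℝ} (hsc : s < c) (hc : c ≤ vbar)
    (hp : 0 < p) (hq : 0 ≤ q) (hpq : (vbar - s) * p = (vbar - c) * q)
    (h : ((k : ℝ) + 1) ^ 2 * (1 - p) < 1) :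
    s + (vbar - s) * secondOrderTail (k + 2) p < c + (vbar - c) * secondOrderTail (k + 2) q := by
  have h1 := mul_lt_mul_of_pos_left (secondOrderTail_tangent_zero_lt k hp h) (sub_pos.2 hsc)
  have h2 := mul_le_mul_of_nonneg_left (secondOrderTail_tangent_le k hp hq h) (sub_nonneg.2 hc)
  set d := ((k : ℝ) + 2) * (k + 1) * p ^ k * (1 - p)
  have h3 : d * ((vbar - s) * p) = d * ((vbar - c) * q) := by rw [hpq]
  linarith

theorem unique_maxmin_reserve_delta1
    (n : ℕ) (hn : 2 ≤ n) (c m vbar : ℝ)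
    (hc : 0 ≤ c) (hcm : c < m) (hmv : m < vbar)
    (hcond : ((n : ℝ) - 1) ^ 2 < (vbar - c) / (m - c)) :
    ∀ r : ℝ, 0 ≤ r → r ≠ c →
      sInf {x | ∃ F, Delta1 m vbar F ∧ x = revenue n c F r} <
        sInf {x | ∃ F, Delta1 m vbar F ∧ x = revenue n c F c} := by
  intro r hr hrc
  obtain ⟨k, rfl⟩ : ∃ k, n = k + 2 := ⟨n - 2, by lia⟩
  have hcast : ((k + 2 : ℕ) : ℝ) - 1 = (k : ℝ) + 1 := by push_cast; ring
  rw [hcast, lt_div_iff₀ (by linarith)] at hcond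
  have hcv : 0 < vbar - c := by linarith
  set q := (vbar - m) / (vbar - c) with hq
  have hq0 : 0 < q := div_pos (by linarith) hcv
  have hq1 : q < 1 := (div_lt_one hcv).2 (by linarith)
  have hqm : (vbar - c) * q = vbar - m := by rw [hq]; field_simp
  have hqk : ((k : ℝ) + 1) ^ 2 * (1 - q) < 1 := by
    have : (vbar - c) * (((k : ℝ) + 1) ^ 2 * (1 - q)) < (vbar - c) * 1 := by
      have : (vbar - c) * (1 - q) = m - c := by linarith
      rw [mul_left_comm, this]; linarith
    exact lt_of_mul_lt_mul_left this hcv.le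
  have hδ : Delta1 m vbar (twoPointCdf m 1 vbar) :=
    delta1_twoPointCdf (by linarith) hmv zero_le_one le_rfl (by ring)
  have hlow : c + (vbar - c) * secondOrderTail (k + 2) q ≤
      sInf {x | ∃ F, Delta1 m vbar F ∧ x = revenue (k + 2) c F c} := by
    refine le_csInf ⟨_, _, hδ, rfl⟩ ?_
    rintro _ ⟨F, hF, rfl⟩
    exact hF.guarantee_le_revenue k hc (by linarith) hq0 hq1.le hqm hqk
  suffices H : ∃ F, Delta1 m vbar F ∧
      revenue (k + 2) c F r < c + (vbar - c) * secondOrderTail (k + 2) q by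
    obtain ⟨F, hF, hlt⟩ := H
    have hbdd : BddBelow {x | ∃ F, Delta1 m vbar F ∧ x = revenue (k + 2) c F r} := by
      refine ⟨r - |r - c|, ?_⟩
      rintro _ ⟨G, hG, rfl⟩
      exact hG.le_revenue k c r
    exact ((csInf_le hbdd ⟨F, hF, rfl⟩).trans_lt hlt).trans_le hlow
  rcases le_or_gt m r with hmr | hrm
  · refine ⟨_, hδ, ?_⟩
    rw [revenue_twoPointCdf_one k c vbar hmr, secondOrderTail_add_two]
    linarith [mul_pos hcv (secondOrderTail_pos k hq0.le hq1)]
  rcases lt_or_gt_of_ne hrc with hlt | hgt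
  · set d := (vbar - c) - ((k : ℝ) + 1) ^ 2 * (m - c) with hd
    have hd0 : 0 < d := by linarith
    have hk : (0 : ℝ) < ((k : ℝ) + 1) ^ 2 := by positivity
    obtain ⟨s, hrs, hsc, hsd⟩ : ∃ s, r < s ∧ s < c ∧ ((k : ℝ) + 1) ^ 2 * (c - s) ≤ d := by
      refine ⟨c - min ((c - r) / 2) (d / ((k : ℝ) + 1) ^ 2), ?_, ?_, ?_⟩
      · linarith [min_le_left ((c - r) / 2) (d / ((k : ℝ) + 1) ^ 2)]
      · linarith [lt_min (show 0 < (c - r) / 2 by linarith) (div_pos hd0 hk)]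
      · rw [sub_sub_cancel, ← le_div_iff₀' hk]
        exact min_le_right _ _
    have hsv : 0 < vbar - s := by linarith
    have hp : 0 < (vbar - m) / (vbar - s) := div_pos (by linarith) hsv
    have hp1 : (vbar - m) / (vbar - s) ≤ 1 := (div_le_one hsv).2 (by linarith)
    have hpm : (vbar - s) * ((vbar - m) / (vbar - s)) = vbar - m := by field_simp
    set p := (vbar - m) / (vbar - s)
    have hF : Delta1 m vbar (twoPointCdf s p vbar) :=
      delta1_twoPointCdf (by linarith) (by linarith) hp.le hp1 hpm
    refine ⟨_, hF, ?_⟩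
    rw [revenue_twoPointCdf_of_lt k c (by linarith) hF hrs]
    refine guarantee_lt_of_atom_lowered k hsc (by linarith) hp hq0.le (hpm.trans hqm.symm) ?_
    have : (vbar - s) * (((k : ℝ) + 1) ^ 2 * (1 - p)) < (vbar - s) * 1 := by
      have : (vbar - s) * (1 - p) = (m - c) + (c - s) := by linarith
      rw [mul_left_comm, this]; linarith
    exact lt_of_mul_lt_mul_left this hsv.le
  · have hrv : 0 < vbar - r := by linarith
    have hp : 0 < (vbar - m) / (vbar - r) := div_pos (by linarith) hrv
    have hp1 : (vbar - m) / (vbar - r) ≤ 1 := (div_le_one hrv).2 (by linarith)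
    have hpm : (vbar - r) * ((vbar - m) / (vbar - r)) = vbar - m := by field_simp
    set p := (vbar - m) / (vbar - r)
    have hF : Delta1 m vbar (twoPointCdf r p vbar) :=
      delta1_twoPointCdf hr (by linarith) hp.le hp1 hpm
    refine ⟨_, hF, ?_⟩
    rw [revenue_twoPointCdf_self k c (by linarith) hF]
    exact revenue_lt_of_atom_raised k hgt (by linarith) hp hp1 (hpm.trans hqm.symm)
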